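/- arXiv:2511.04456 — 3 statements merged into one kernel-verified Lean document; each statement's English description precedes it below -/
import Mathlib

section
/- Under Assumptions 1–3 (matrix form), the FedMuon-DA iterates satisfy, for every round t: E[f(X_t, Y_t)] − E[f(X_{t+1}, Y_{t+1})] ≤ γ_x √(n_x) E[‖∇Φ(X_t)‖_F] + (γ_x √(n_x) κ − γ_y) E[‖∇_Y f(X_t, Y_t)‖_F] + 2γ_x √(n_x) E[‖∇_X f(X_t, Y_t) − U_t‖_F] + 2γ_y √(n_y) E[‖∇_Y f(X_t, Y_t) − V_t‖_F] + 2γ_y √(n_y)·(1/(Np)) Σ_{n,i} E[‖V_t − V^{(n)}_{t,i}‖_F] + 2γ_x √(n_x)·(1/(Np)) Σ_{n,i} E[‖U_t − U^{(n)}_{t,i}‖_F] + (L_f/2)(γ_x² n_x + γ_y² n_y + 2 n_x γ_x γ_y). -/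
open MeasureTheory Matrix

/-- Identify a point of `EuclideanSpace ℝ (Fin m × Fin n)` (whose norm is exactly the
Frobenius norm) with an `m × n` matrix. -/
def euclToMatrix {m n : ℕ} (A : EuclideanSpace ℝ (Fin m × Fin n)) :
    Matrix (Fin m) (Fin n) ℝ :=
  Matrix.of fun i j => A (i, j)

section Analysis

open Filter Topology

/-- A partial gradient that is one component of a jointly Lipschitz field is continuous. -/
lemma continuous_of_norm_sub_le_sqrt {A B C : Type*} [NormedAddCommGroup A]
    [NormedAddCommGroup B] [NormedAddCommGroup C] {G : A → B → C}
    {L : ℝ}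
    (hG : ∀ X Y X' Y', ‖G X Y - G X' Y'‖ ≤ L * √(‖X - X'‖ ^ 2 + ‖Y - Y'‖ ^ 2)) :
    Continuous fun z : A × B => G z.1 z.2 := by
  rw [continuous_iff_continuousAt]
  intro u
  rw [ContinuousAt, tendsto_iff_norm_sub_tendsto_zero]
  refine squeeze_zero (fun _ => norm_nonneg _) (fun z => hG z.1 z.2 u.1 u.2) ?_
  have : Continuous fun z : A × B => L * √(‖z.1 - u.1‖ ^ 2 + ‖z.2 - u.2‖ ^ 2) := by fun_prop
  simpa using this.tendsto u

variable {A B : Type*} [NormedAddCommGroup A] [InnerProductSpace ℝ A] [CompleteSpace A]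
  [NormedAddCommGroup B] [InnerProductSpace ℝ B] [CompleteSpace B]

lemma hasFDerivAt_uncurry_of_hasGradientAt {f : A → B → ℝ} {Gx : A → B → A} {Gy : A → B → B}
    (hGx : ∀ X Y, HasGradientAt (fun X' => f X' Y) (Gx X Y) X)
    (hGy : ∀ X Y, HasGradientAt (fun Y' => f X Y') (Gy X Y) Y)
    (hcx : Continuous fun z : A × B => Gx z.1 z.2)
    (hcy : Continuous fun z : A × B => Gy z.1 z.2) (u : A × B) :
    HasFDerivAt (fun z : A × B => f z.1 z.2)
      ((innerSL ℝ (Gx u.1 u.2)).coprod (innerSL ℝ (Gy u.1 u.2))) u := by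
  refine (hasStrictFDerivAt_uncurry_coprod (𝕜 := ℝ) (f := f)
    (f₁ := fun X Y => innerSL ℝ (Gx X Y)) (f₂ := fun X Y => innerSL ℝ (Gy X Y))
    (.of_forall fun v => ?_) (.of_forall fun v => ?_) ?_ ?_).hasFDerivAt
  · exact (hGx v.1 v.2).hasFDerivAt
  · exact (hGy v.1 v.2).hasFDerivAt
  · exact ((innerSL ℝ).continuous.comp hcx).continuousAt
  · exact ((innerSL ℝ).continuous.comp hcy).continuousAt

/-- The descent lemma for a function of two blocks whose joint gradient is Lipschitz. -/
lemma sub_le_of_lipschitz_partial_gradients {f : A → B → ℝ} {Gx : A → B → A} {Gy : A → B → B}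
    {L : ℝ} (hGx : ∀ X Y, HasGradientAt (fun X' => f X' Y) (Gx X Y) X)
    (hGy : ∀ X Y, HasGradientAt (fun Y' => f X Y') (Gy X Y) Y)
    (hLip : ∀ X Y X' Y', √(‖Gx X Y - Gx X' Y'‖ ^ 2 + ‖Gy X Y - Gy X' Y'‖ ^ 2) ≤
        L * √(‖X - X'‖ ^ 2 + ‖Y - Y'‖ ^ 2))
    (hcx : Continuous fun z : A × B => Gx z.1 z.2)
    (hcy : Continuous fun z : A × B => Gy z.1 z.2) (X a : A) (Y b : B) :
    f X Y - f (X + a) (Y + b) ≤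
      -inner ℝ (Gx X Y) a - inner ℝ (Gy X Y) b + L / 2 * (‖a‖ ^ 2 + ‖b‖ ^ 2) := by
  set D := ‖a‖ ^ 2 + ‖b‖ ^ 2 with hD
  have hD0 : 0 ≤ D := by positivity
  set ψ : ℝ → ℝ := fun s => f (X + s • a) (Y + s • b) -
    s * (inner ℝ (Gx X Y) a + inner ℝ (Gy X Y) b) + L / 2 * D * s ^ 2 with hψ
  have hder : ∀ s, HasDerivAt ψ (inner ℝ (Gx (X + s • a) (Y + s • b) - Gx X Y) a +
      inner ℝ (Gy (X + s • a) (Y + s • b) - Gy X Y) b + L * D * s) s := by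
    intro s
    have hpath : HasDerivAt (fun s : ℝ => (X + s • a, Y + s • b)) (a, b) s := by
      have h1 : HasDerivAt (fun s : ℝ => X + s • a) a s := by
        simpa using ((hasDerivAt_id s).smul_const a).const_add X
      have h2 : HasDerivAt (fun s : ℝ => Y + s • b) b s := by
        simpa using ((hasDerivAt_id s).smul_const b).const_add Y
      exact h1.prodMk h2
    have h := (hasFDerivAt_uncurry_of_hasGradientAt hGx hGy hcx hcy
      (X + s • a, Y + s • b)).comp_hasDerivAt s hpath
    have h3 := (h.sub ((hasDerivAt_id s).mul_const
      (inner ℝ (Gx X Y) a + inner ℝ (Gy X Y) b))).add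
      ((hasDerivAt_pow 2 s).const_mul (L / 2 * D))
    refine h3.congr_deriv ?_
    simp [inner_sub_left]
    ring
  have hnonneg : ∀ s, 0 < s → 0 ≤ inner ℝ (Gx (X + s • a) (Y + s • b) - Gx X Y) a +
      inner ℝ (Gy (X + s • a) (Y + s • b) - Gy X Y) b + L * D * s := by
    intro s hs
    set p := Gx (X + s • a) (Y + s • b) - Gx X Y
    set q := Gy (X + s • a) (Y + s • b) - Gy X Y
    have h1 : √(‖p‖ ^ 2 + ‖q‖ ^ 2) ≤ L * (s * √D) := by
      have h := hLip (X + s • a) (Y + s • b) X Y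
      have e : ‖X + s • a - X‖ ^ 2 + ‖Y + s • b - Y‖ ^ 2 = s ^ 2 * D := by
        simp [norm_smul, mul_pow, hD]; ring
      rwa [e, Real.sqrt_mul (sq_nonneg s), Real.sqrt_sq hs.le] at h
    have h2 : ‖p‖ * ‖a‖ + ‖q‖ * ‖b‖ ≤ √(‖p‖ ^ 2 + ‖q‖ ^ 2) * √D := by
      rw [← Real.sqrt_mul (by positivity)]
      apply Real.le_sqrt_of_sq_le
      nlinarith [sq_nonneg (‖p‖ * ‖b‖ - ‖q‖ * ‖a‖)]
    have h3 : √(‖p‖ ^ 2 + ‖q‖ ^ 2) * √D ≤ L * (s * √D) * √D :=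
      mul_le_mul_of_nonneg_right h1 (Real.sqrt_nonneg _)
    have h4 : L * (s * √D) * √D = L * D * s := by
      rw [show L * (s * √D) * √D = L * s * (√D * √D) by ring, Real.mul_self_sqrt hD0]; ring
    have h5 := neg_le_of_abs_le (abs_real_inner_le_norm p a)
    have h6 := neg_le_of_abs_le (abs_real_inner_le_norm q b)
    linarith
  have hmono : MonotoneOn ψ (Set.Icc 0 1) := by
    refine monotoneOn_of_deriv_nonneg (convex_Icc 0 1)
      (fun s _ => (hder s).continuousAt.continuousWithinAt)
      (fun s _ => (hder s).differentiableAt.differentiableWithinAt) fun s hs => ?_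
    rw [interior_Icc] at hs
    rw [(hder s).deriv]
    exact hnonneg s hs.1
  have h01 := hmono (by simp) (by simp) zero_le_one
  simp [hψ] at h01
  linarith

/-- Under the Polyak-Łojasiewicz condition with constant `m > 2 c²`, every point `Y` has a maximizer
within distance `√(M - g Y) / c`. -/
lemma exists_maximizer_norm_sub_le_of_pl [FiniteDimensional ℝ B] {g : B → ℝ} {G : B → B} {M m c : ℝ}
    (hG : ∀ Y, HasGradientAt g (G Y) Y) (hM : ∀ Y, g Y ≤ M)
    (hPL : ∀ Y, 2 * m * (M - g Y) ≤ ‖G Y‖ ^ 2) (hc : 0 < c) (hcm : 2 * c ^ 2 < m) (Y : B) :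
    ∃ Z, g Z = M ∧ c * ‖Z - Y‖ ≤ √(M - g Y) := by
  have hgc : Continuous g := continuous_iff_continuousAt.2 fun Y => (hG Y).continuousAt
  have hcont : Continuous fun Z => √(M - g Z) + c * ‖Z - Y‖ := by fun_prop
  have hcoer : Tendsto (fun Z => √(M - g Z) + c * ‖Z - Y‖) (cocompact B) atTop := by
    refine tendsto_atTop_mono (fun Z => ?_)
      ((tendsto_norm_cocompact_atTop (E := B)).const_mul_atTop hc |>.atTop_add
        (tendsto_const_nhds (x := -(c * ‖Y‖))))
    have := norm_sub_norm_le Z Y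
    nlinarith [Real.sqrt_nonneg (M - g Z)]
  obtain ⟨Z, hZ⟩ := hcont.exists_forall_le hcoer
  have hZY := hZ Y
  simp only [sub_self, norm_zero, mul_zero, add_zero] at hZY
  refine ⟨Z, ?_, by linarith [Real.sqrt_nonneg (M - g Z)]⟩
  by_contra hne
  have hpos : 0 < M - g Z := sub_pos.2 (lt_of_le_of_ne (hM Z) hne)
  set v := G Z
  set h := √(M - g Z) with hh
  have hh0 : 0 < h := Real.sqrt_pos.2 hpos
  have hhsq : h ^ 2 = M - g Z := Real.sq_sqrt hpos.le
  have hder : HasDerivAt (fun s : ℝ => √(M - g (Z + s • v)) + s * (c * ‖v‖))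
      (-‖v‖ ^ 2 / (2 * h) + c * ‖v‖) 0 := by
    have h2 : HasDerivAt (fun s : ℝ => Z + s • v) v 0 := by
      simpa using ((hasDerivAt_id (0 : ℝ)).smul_const v).const_add Z
    have h3 : HasDerivAt (fun s : ℝ => g (Z + s • v)) (‖v‖ ^ 2) 0 := by
      have := HasFDerivAt.comp_hasDerivAt_of_eq (0 : ℝ) (hG Z).hasFDerivAt h2 (by simp)
      refine this.congr_deriv ?_
      simp [v]
    have h4 := (h3.const_sub M).sqrt (by simpa using hpos.ne')
    have h5 := h4.add ((hasDerivAt_id (0 : ℝ)).mul_const (c * ‖v‖))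
    refine h5.congr_deriv ?_
    simp [hh]
  have hslope := hder.tendsto_slope_zero_right
  have hge : 0 ≤ -‖v‖ ^ 2 / (2 * h) + c * ‖v‖ := by
    refine ge_of_tendsto hslope ?_
    filter_upwards [self_mem_nhdsWithin] with s hs
    have hs0 : 0 < s := hs
    have h1 := hZ (Z + s • v)
    have h2 : ‖Z + s • v - Y‖ ≤ ‖Z - Y‖ + s * ‖v‖ := by
      rw [show Z + s • v - Y = (Z - Y) + s • v by abel]
      refine (norm_add_le _ _).trans ?_
      rw [norm_smul, Real.norm_of_nonneg hs0.le]
    simp only [zero_add, zero_smul, add_zero, zero_mul, smul_eq_mul]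
    refine mul_nonneg (inv_nonneg.2 hs0.le) ?_
    nlinarith [mul_le_mul_of_nonneg_left h2 hc.le]
  have hPLZ := hPL Z
  rw [← hhsq] at hPLZ
  have hle : ‖v‖ ^ 2 ≤ c * ‖v‖ * (2 * h) := by
    rw [neg_div, neg_add_eq_sub, sub_nonneg, div_le_iff₀ (by positivity)] at hge
    exact hge
  change 2 * m * h ^ 2 ≤ ‖v‖ ^ 2 at hPLZ
  nlinarith [mul_lt_mul_of_pos_right hcm (pow_pos hh0 2), sq_nonneg (‖v‖ - 2 * c * h)]

/-- A minorant of `Φ` touching it at `X` shares its gradient there. -/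
lemma eq_gradient_of_le_of_eq {Φ g : A → ℝ} {P G X : A} (hΦ : HasGradientAt Φ P X)
    (hg : HasGradientAt g G X) (hle : ∀ X', g X' ≤ Φ X') (heq : g X = Φ X) : G = P := by
  have hmin : IsLocalMin (fun X' => Φ X' - g X') X := by
    refine .of_forall fun X' => ?_
    have := hle X'
    simp only
    linarith
  have h0 := hmin.hasFDerivAt_eq_zero (hΦ.hasFDerivAt.sub hg.hasFDerivAt)
  rw [sub_eq_zero] at h0
  exact ((InnerProductSpace.toDual ℝ A).injective h0).symm

/-- Under the Polyak-Łojasiewicz condition in the second block, the partial gradient in the first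
block is close to the gradient of the partial maximum. -/
lemma norm_partial_gradient_sub_le_of_pl [FiniteDimensional ℝ B] {f : A → B → ℝ} {Gx : A → B → A}
    {Gy : A → B → B} {Φ : A → ℝ} {L m : ℝ} {X P : A} (hL : 0 ≤ L) (hm : 0 < m)
    (hGx : ∀ Y, HasGradientAt (fun X' => f X' Y) (Gx X Y) X)
    (hGy : ∀ Y, HasGradientAt (fun Y' => f X Y') (Gy X Y) Y)
    (hΦ : HasGradientAt Φ P X) (hle : ∀ X Y, f X Y ≤ Φ X)
    (hPL : ∀ Y, 2 * m * (Φ X - f X Y) ≤ ‖Gy X Y‖ ^ 2)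
    (hLip : ∀ Y Y', ‖Gx X Y - Gx X Y'‖ ≤ L * ‖Y - Y'‖) (Y : B) :
    ‖Gx X Y - P‖ ≤ L / m * ‖Gy X Y‖ := by
  set h := √(Φ X - f X Y) with hh
  have hh0 : 0 ≤ h := Real.sqrt_nonneg _
  have hhsq : h ^ 2 = Φ X - f X Y := Real.sq_sqrt (sub_nonneg.2 (hle X Y))
  have key : ∀ c, 0 < c → 2 * c ^ 2 < m → c * ‖Gx X Y - P‖ ≤ L * h := by
    intro c hc hcm
    obtain ⟨Z, hZ, hZY⟩ := exists_maximizer_norm_sub_le_of_pl hGy (hle X) hPL hc hcm Y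
    have hP : Gx X Z = P := eq_gradient_of_le_of_eq hΦ (hGx Z) (fun X' => hle X' Z) hZ
    have h1 := hLip Y Z
    rw [hP, norm_sub_rev Y Z] at h1
    calc c * ‖Gx X Y - P‖ ≤ c * (L * ‖Z - Y‖) := by gcongr
      _ = L * (c * ‖Z - Y‖) := by ring
      _ ≤ L * h := by gcongr
  have hlim : √(m / 2) * ‖Gx X Y - P‖ ≤ L * h := by
    have hs : 0 < √(m / 2) := Real.sqrt_pos.2 (by positivity)
    have ht : Tendsto (fun c : ℝ => c * ‖Gx X Y - P‖) (𝓝[<] √(m / 2))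
        (𝓝 (√(m / 2) * ‖Gx X Y - P‖)) :=
      ((continuous_id.mul continuous_const).tendsto _).mono_left nhdsWithin_le_nhds
    refine le_of_tendsto ht ?_
    filter_upwards [Ioo_mem_nhdsLT hs] with c hc
    refine key c hc.1 ?_
    have := (Real.lt_sqrt hc.1.le).1 hc.2
    linarith
  have hsq : √(m / 2) ^ 2 = m / 2 := Real.sq_sqrt (by positivity)
  have hG : 2 * √(m / 2) * h ≤ ‖Gy X Y‖ := by
    refine abs_le_of_sq_le_sq' ?_ (norm_nonneg _) |>.2
    have := hPL Y
    rw [← hhsq] at this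
    rw [mul_pow, mul_pow, hsq]
    linarith
  rw [div_mul_eq_mul_div, le_div_iff₀ hm]
  have h1 : 2 * √(m / 2) * (√(m / 2) * ‖Gx X Y - P‖) ≤ 2 * √(m / 2) * (L * h) := by gcongr
  have h2 : L * (2 * √(m / 2) * h) ≤ L * ‖Gy X Y‖ := by gcongr
  have h3 : 2 * √(m / 2) * (√(m / 2) * ‖Gx X Y - P‖) = ‖Gx X Y - P‖ * m := by
    rw [show 2 * √(m / 2) * (√(m / 2) * ‖Gx X Y - P‖) = 2 * √(m / 2) ^ 2 * ‖Gx X Y - P‖ by ring,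
      hsq]; ring
  linarith

end Analysis

section OrthonormalizedSteps

variable {m n : ℕ}

lemma inner_eq_trace_euclToMatrix (A B : EuclideanSpace ℝ (Fin m × Fin n)) :
    inner ℝ A B = ((euclToMatrix A)ᵀ * euclToMatrix B).trace := by
  simp only [PiLp.inner_apply, Fintype.sum_prod_type, Matrix.trace, Matrix.diag_apply,
    Matrix.mul_apply, Matrix.transpose_apply, euclToMatrix, Matrix.of_apply]
  rw [Finset.sum_comm]
  simp [mul_comm]

lemma le_of_transpose_mul_self_eq_one {r : ℕ} {Q : Matrix (Fin n) (Fin r) ℝ} (hQ : Qᵀ * Q = 1) :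
    r ≤ n := by
  have h := Matrix.rank_mul_le_right Qᵀ Q
  rw [hQ, Matrix.rank_one, Fintype.card_fin] at h
  simpa using h.trans (Matrix.rank_le_height Q)

lemma trace_orthonormal_mul {r : ℕ} {P : Matrix (Fin m) (Fin r) ℝ} {Q : Matrix (Fin n) (Fin r) ℝ}
    (hP : Pᵀ * P = 1) (hQ : Qᵀ * Q = 1) (C D : Matrix (Fin r) (Fin r) ℝ) :
    ((P * C * Qᵀ)ᵀ * (P * D * Qᵀ)).trace = (Cᵀ * D).trace := by
  have h : (P * C * Qᵀ)ᵀ * (P * D * Qᵀ) = Q * (Cᵀ * D * Qᵀ) := by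
    simp only [Matrix.transpose_mul, Matrix.transpose_transpose, Matrix.mul_assoc]
    rw [← Matrix.mul_assoc Pᵀ P, hP, Matrix.one_mul]
  rw [h, Matrix.trace_mul_comm, Matrix.mul_assoc, hQ, Matrix.mul_one]

/-- The polar factor `P Qᵀ` of `V` has Frobenius norm at most `√n`, and its inner product
with `V` is the nuclear norm of `V`, hence at least the Frobenius norm. -/
lemma norm_polar_factor_le {r : ℕ} {P : Matrix (Fin m) (Fin r) ℝ} {Q : Matrix (Fin n) (Fin r) ℝ}
    {sv : Fin r → ℝ} (hP : Pᵀ * P = 1) (hQ : Qᵀ * Q = 1) (hsv : ∀ j, 0 < sv j)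
    {V W : EuclideanSpace ℝ (Fin m × Fin n)} (hV : euclToMatrix V = P * diagonal sv * Qᵀ)
    (hW : euclToMatrix W = P * Qᵀ) : ‖W‖ ≤ √n ∧ ‖V‖ ≤ inner ℝ V W := by
  have hW' : euclToMatrix W = P * (1 : Matrix (Fin r) (Fin r) ℝ) * Qᵀ := by rw [hW, Matrix.mul_one]
  constructor
  · apply Real.le_sqrt_of_sq_le
    rw [← real_inner_self_eq_norm_sq, inner_eq_trace_euclToMatrix, hW', trace_orthonormal_mul hP hQ]
    simpa using le_of_transpose_mul_self_eq_one hQ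
  · have hVW : inner ℝ V W = ∑ j, sv j := by
      rw [inner_eq_trace_euclToMatrix, hV, hW', trace_orthonormal_mul hP hQ]
      simp [Matrix.trace]
    have hVV : ‖V‖ ^ 2 = ∑ j, sv j ^ 2 := by
      rw [← real_inner_self_eq_norm_sq, inner_eq_trace_euclToMatrix, hV,
        trace_orthonormal_mul hP hQ]
      simp [Matrix.trace, sq]
    rw [hVW]
    refine abs_le_of_sq_le_sq' ?_ (Finset.sum_nonneg fun j _ => (hsv j).le) |>.2
    rw [hVV]
    exact Finset.sum_sq_le_sq_sum_of_nonneg fun j _ => (hsv j).le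

lemma norm_sub_le_inner_of_norm_le_inner {V W : EuclideanSpace ℝ (Fin m × Fin n)}
    (hW : ‖W‖ ≤ √n) (hVW : ‖V‖ ≤ inner ℝ V W) (G : EuclideanSpace ℝ (Fin m × Fin n)) :
    ‖G‖ - 2 * √n * ‖G - V‖ ≤ inner ℝ G W := by
  rcases Nat.eq_zero_or_pos n with rfl | hn
  · simp [Subsingleton.elim G 0]
  have hn1 : 1 ≤ √(n : ℝ) := Real.one_le_sqrt.2 (by exact_mod_cast hn)
  have h1 := neg_le_of_abs_le (abs_real_inner_le_norm (G - V) W)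
  have h2 : ‖G - V‖ * ‖W‖ ≤ ‖G - V‖ * √n := by gcongr
  have h3 : inner ℝ G W = inner ℝ V W + inner ℝ (G - V) W := by rw [inner_sub_left]; ring
  have h4 := norm_sub_norm_le G V
  nlinarith [norm_nonneg (G - V)]

/-- Averaging the displacements of `p` orthonormalized local steps over `N` clients gives a global
step whose direction `W` has norm at most `√n` and is well aligned with any `G`, up to the
distance between `G` and the local momenta. -/
lemma exists_average_orthonormalized_step {N p : ℕ} (hN : 0 < N) (hp : 0 < p) {η : ℝ} (hη : η ≠ 0)
    (γ : ℝ) {Z : EuclideanSpace ℝ (Fin m × Fin n)}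
    {Zl M : Fin N → ℕ → EuclideanSpace ℝ (Fin m × Fin n)} (h0 : ∀ k, Zl k 0 = Z)
    (hS : ∀ k i, i < p → ∃ (r : ℕ) (P : Matrix (Fin m) (Fin r) ℝ)
      (Q : Matrix (Fin n) (Fin r) ℝ) (sv : Fin r → ℝ),
      Pᵀ * P = 1 ∧ Qᵀ * Q = 1 ∧ (∀ j, 0 < sv j) ∧
      euclToMatrix (M k i) = P * diagonal sv * Qᵀ ∧
      euclToMatrix (Zl k (i + 1)) = euclToMatrix (Zl k i) + η • (P * Qᵀ)) :
    ∃ W : EuclideanSpace ℝ (Fin m × Fin n),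
      (γ / (η * N * p)) • ∑ k, (Zl k p - Z) = γ • W ∧ ‖W‖ ≤ √n ∧
      ∀ G V, ‖G‖ - 2 * √n * (‖G - V‖ +
        (1 : ℝ) / (N * p) * ∑ k : Fin N, ∑ i ∈ Finset.range p, ‖V - M k i‖) ≤ inner ℝ G W := by
  set W : Fin N → ℕ → EuclideanSpace ℝ (Fin m × Fin n) :=
    fun k i => η⁻¹ • (Zl k (i + 1) - Zl k i) with hWdef
  have hW : ∀ k, ∀ i ∈ Finset.range p, ‖W k i‖ ≤ √n ∧ ‖M k i‖ ≤ inner ℝ (M k i) (W k i) := by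
    intro k i hi
    obtain ⟨r, P, Q, sv, hP, hQ, hsv, hM, hZ⟩ := hS k i (Finset.mem_range.1 hi)
    refine norm_polar_factor_le hP hQ hsv hM ?_
    have e : euclToMatrix (W k i) =
        η⁻¹ • (euclToMatrix (Zl k (i + 1)) - euclToMatrix (Zl k i)) := by
      ext; simp [euclToMatrix, hWdef]
    rw [e, hZ, add_sub_cancel_left, smul_smul, inv_mul_cancel₀ hη, one_smul]
  have hN' : (0 : ℝ) < N := by exact_mod_cast hN
  have hp' : (0 : ℝ) < p := by exact_mod_cast hp
  have hconst : ∀ c : ℝ, (1 : ℝ) / (N * p) * ∑ _k : Fin N, ∑ _i ∈ Finset.range p, c = c := by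
    intro c
    simp only [Finset.sum_const, Finset.card_univ, Fintype.card_fin, Finset.card_range,
      nsmul_eq_mul]
    field_simp
  refine ⟨((1 : ℝ) / (N * p)) • ∑ k, ∑ i ∈ Finset.range p, W k i, ?_, ?_, fun G V => ?_⟩
  · have hsum : ∀ k, ∑ i ∈ Finset.range p, W k i = η⁻¹ • (Zl k p - Z) := by
      intro k
      rw [hWdef, ← Finset.smul_sum, Finset.sum_range_sub, h0]
    simp_rw [hsum]
    rw [← Finset.smul_sum, smul_smul, smul_smul]
    congr 1
    field_simp
  · rw [norm_smul, Real.norm_of_nonneg (by positivity)]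
    refine le_trans ?_ (hconst (√n)).le
    gcongr
    refine (norm_sum_le _ _).trans (Finset.sum_le_sum fun k _ => ?_)
    exact (norm_sum_le _ _).trans (Finset.sum_le_sum fun i hi => (hW k i hi).1)
  · rw [inner_smul_right, inner_sum]
    simp_rw [inner_sum]
    calc ‖G‖ - 2 * √n * (‖G - V‖ +
          (1 : ℝ) / (N * p) * ∑ k : Fin N, ∑ i ∈ Finset.range p, ‖V - M k i‖)
        = (1 : ℝ) / (N * p) * ∑ k : Fin N, ∑ i ∈ Finset.range p,
            ((‖G‖ - 2 * √n * ‖G - V‖) - 2 * √n * ‖V - M k i‖) := by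
          simp_rw [Finset.sum_sub_distrib, ← Finset.mul_sum]
          linear_combination 2 * √n * hconst ‖G - V‖ - hconst ‖G‖
      _ ≤ _ := by
          gcongr with k _ i hi
          refine le_trans ?_ (norm_sub_le_inner_of_norm_le_inner (hW k i hi).1 (hW k i hi).2 G)
          have := norm_sub_le_norm_sub_add_norm_sub G V (M k i)
          nlinarith [Real.sqrt_nonneg (n : ℝ)]

end OrthonormalizedSteps

section Integrability

/-- A continuous function of bounded random variables in proper spaces is integrable. -/
lemma integrable_of_continuous_of_bounded {Ω A B C : Type*} {mΩ : MeasurableSpace Ω}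
    {μ : Measure Ω} [IsFiniteMeasure μ] [NormedAddCommGroup A] [ProperSpace A]
    [NormedAddCommGroup B] [ProperSpace B] [NormedAddCommGroup C] {H : A × B → C}
    (hH : Continuous H) {X : Ω → A} {Y : Ω → B} (hX : StronglyMeasurable X)
    (hY : StronglyMeasurable Y) (hbX : ∃ c, ∀ ω, ‖X ω‖ ≤ c) (hbY : ∃ c, ∀ ω, ‖Y ω‖ ≤ c) :
    Integrable (fun ω => H (X ω, Y ω)) μ := by
  obtain ⟨c, hc⟩ := hbX
  obtain ⟨d, hd⟩ := hbY
  obtain ⟨K, hK⟩ := ((isCompact_closedBall (0 : A) c).prod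
    (isCompact_closedBall (0 : B) d)).exists_bound_of_continuousOn hH.continuousOn
  refine Integrable.of_bound
    (hH.comp_stronglyMeasurable (hX.prodMk hY)).aestronglyMeasurable K (.of_forall fun ω => ?_)
  exact hK _ ⟨by simpa using hc ω, by simpa using hd ω⟩

lemma measurable_of_hasGradientAt {A : Type*} [NormedAddCommGroup A] [InnerProductSpace ℝ A]
    [CompleteSpace A] [MeasurableSpace A] [BorelSpace A] {Φ : A → ℝ} {G : A → A}
    (hG : ∀ X, HasGradientAt Φ (G X) X) : Measurable G := by
  have h : G = fun X => (InnerProductSpace.toDual ℝ A).symm (fderiv ℝ Φ X) := by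
    funext X
    rw [(hG X).hasFDerivAt.fderiv, LinearIsometryEquiv.symm_apply_apply]
  rw [h]
  exact (InnerProductSpace.toDual ℝ A).symm.continuous.measurable.comp (measurable_fderiv ℝ Φ)

end Integrability

set_option maxHeartbeats 1000000 in
/-- descent of the objective along FedMuon-DA, matrix form:
for every round `t`, `E[f(X_t,Y_t)] − E[f(X_{t+1},Y_{t+1})]` is bounded as stated,
with `κ = L_f/μ`. -/
theorem fedmuon_da_objective_descent
    {mx nx my ny : ℕ} {Ω : Type} {mΩ : MeasurableSpace Ω}
    (μ : Measure Ω) [IsProbabilityMeasure μ]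
    (F : Filtration ℕ mΩ)
    (N p : ℕ) (hN : 0 < N) (hp : 0 < p)
    (Lf mupl sigma s : ℝ) (hLf : 0 < Lf) (hmupl : 0 < mupl) (hsigma : 0 < sigma)
    (hs1 : 1 < s) (hs2 : s ≤ 2)
    (gammax gammay etax etay betax betay : ℝ)
    (hgammax : 0 < gammax) (hgammay : 0 < gammay)
    (hetax : 0 < etax) (hetay : 0 < etay)
    (hbetax0 : 0 < betax) (hbetax1 : betax < 1)
    (hbetay0 : 0 < betay) (hbetay1 : betay < 1)
    -- Assumption 1 (smoothness): component losses on matrix variables (identified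
    -- with points of a Euclidean space carrying the Frobenius norm), their partial
    -- gradients, and joint `Lf`-Lipschitzness of the full gradients
    (f : Fin N → EuclideanSpace ℝ (Fin mx × Fin nx) → EuclideanSpace ℝ (Fin my × Fin ny) → ℝ)
    (Gx : Fin N → EuclideanSpace ℝ (Fin mx × Fin nx) → EuclideanSpace ℝ (Fin my × Fin ny) → EuclideanSpace ℝ (Fin mx × Fin nx))
    (Gy : Fin N → EuclideanSpace ℝ (Fin mx × Fin nx) → EuclideanSpace ℝ (Fin my × Fin ny) → EuclideanSpace ℝ (Fin my × Fin ny))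
    (hGx : ∀ n X Y, HasGradientAt (fun X' => f n X' Y) (Gx n X Y) X)
    (hGy : ∀ n X Y, HasGradientAt (fun Y' => f n X Y') (Gy n X Y) Y)
    (hLip : ∀ n X Y X' Y',
      Real.sqrt (‖Gx n X Y - Gx n X' Y'‖ ^ 2 + ‖Gy n X Y - Gy n X' Y'‖ ^ 2) ≤
        Lf * Real.sqrt (‖X - X'‖ ^ 2 + ‖Y - Y'‖ ^ 2))
    -- the global objective `f = (1/N) ∑ f⁽ⁿ⁾` and its partial gradients
    (fbar : EuclideanSpace ℝ (Fin mx × Fin nx) → EuclideanSpace ℝ (Fin my × Fin ny) → ℝ)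
    (hfbar : ∀ X Y, fbar X Y = (N : ℝ)⁻¹ * ∑ n, f n X Y)
    (Gxbar : EuclideanSpace ℝ (Fin mx × Fin nx) → EuclideanSpace ℝ (Fin my × Fin ny) → EuclideanSpace ℝ (Fin mx × Fin nx))
    (hGxbar : ∀ X Y, Gxbar X Y = (N : ℝ)⁻¹ • ∑ n, Gx n X Y)
    (Gybar : EuclideanSpace ℝ (Fin mx × Fin nx) → EuclideanSpace ℝ (Fin my × Fin ny) → EuclideanSpace ℝ (Fin my × Fin ny))
    (hGybar : ∀ X Y, Gybar X Y = (N : ℝ)⁻¹ • ∑ n, Gy n X Y)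
    -- Assumption 2 (PL condition in Y, with maximizer selection `Ystar`)
    (Ystar : EuclideanSpace ℝ (Fin mx × Fin nx) → EuclideanSpace ℝ (Fin my × Fin ny))
    (hYstar : ∀ X Y, fbar X Y ≤ fbar X (Ystar X))
    (hPL : ∀ X Y, 2 * mupl * (fbar X (Ystar X) - fbar X Y) ≤ ‖Gybar X Y‖ ^ 2)
    -- the primal function Φ(X) = max_Y f(X,Y) and its gradient
    (Phi : EuclideanSpace ℝ (Fin mx × Fin nx) → ℝ)
    (hPhi : ∀ X, Phi X = fbar X (Ystar X))
    (GPhi : EuclideanSpace ℝ (Fin mx × Fin nx) → EuclideanSpace ℝ (Fin mx × Fin nx))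
    (hGPhi : ∀ X, HasGradientAt Phi (GPhi X) X)
    -- the random processes generated by FedMuon-DA
    (Xg : ℕ → Ω → EuclideanSpace ℝ (Fin mx × Fin nx)) (Yg : ℕ → Ω → EuclideanSpace ℝ (Fin my × Fin ny))
    (Xl : Fin N → ℕ → ℕ → Ω → EuclideanSpace ℝ (Fin mx × Fin nx))
    (Yl : Fin N → ℕ → ℕ → Ω → EuclideanSpace ℝ (Fin my × Fin ny))
    (Ul : Fin N → ℕ → ℕ → Ω → EuclideanSpace ℝ (Fin mx × Fin nx))
    (Vl : Fin N → ℕ → ℕ → Ω → EuclideanSpace ℝ (Fin my × Fin ny))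
    (Ug : ℕ → Ω → EuclideanSpace ℝ (Fin mx × Fin nx)) (Vg : ℕ → Ω → EuclideanSpace ℝ (Fin my × Fin ny))
    (Dx : Fin N → ℕ → ℕ → Ω → EuclideanSpace ℝ (Fin mx × Fin nx))
    (Dy : Fin N → ℕ → ℕ → Ω → EuclideanSpace ℝ (Fin my × Fin ny))
    (gXl : Fin N → ℕ → Ω → EuclideanSpace ℝ (Fin mx × Fin nx))
    (gYl : Fin N → ℕ → Ω → EuclideanSpace ℝ (Fin my × Fin ny))
    (gXg : ℕ → Ω → EuclideanSpace ℝ (Fin mx × Fin nx)) (gYg : ℕ → Ω → EuclideanSpace ℝ (Fin my × Fin ny))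
    (Uinit : Ω → EuclideanSpace ℝ (Fin mx × Fin nx)) (Vinit : Ω → EuclideanSpace ℝ (Fin my × Fin ny))
    (gXinit : Ω → EuclideanSpace ℝ (Fin mx × Fin nx)) (gYinit : Ω → EuclideanSpace ℝ (Fin my × Fin ny))
    (gXlinit : Fin N → Ω → EuclideanSpace ℝ (Fin mx × Fin nx))
    (gYlinit : Fin N → Ω → EuclideanSpace ℝ (Fin my × Fin ny))
    (X0 : EuclideanSpace ℝ (Fin mx × Fin nx)) (Y0 : EuclideanSpace ℝ (Fin my × Fin ny))
    (hX0 : Xg 0 = fun _ => X0) (hY0 : Yg 0 = fun _ => Y0)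
    (hminit : StronglyMeasurable Uinit ∧ StronglyMeasurable Vinit ∧
      StronglyMeasurable gXinit ∧ StronglyMeasurable gYinit ∧
      (∀ n, StronglyMeasurable (gXlinit n)) ∧ (∀ n, StronglyMeasurable (gYlinit n)))
    (hinitint : Integrable Uinit μ ∧ Integrable Vinit μ ∧ Integrable gXinit μ ∧
      Integrable gYinit μ ∧ (∀ n, Integrable (gXlinit n) μ) ∧
      (∀ n, Integrable (gYlinit n) μ))
    -- algorithm dynamics: Muon local updates via a reduced SVD of the local momentum
    (hXl0 : ∀ n t, Xl n t 0 = Xg t) (hYl0 : ∀ n t, Yl n t 0 = Yg t)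
    (hXlS : ∀ n t i, i < p → ∀ ω, ∃ (r : ℕ) (P : Matrix (Fin mx) (Fin r) ℝ)
      (Q : Matrix (Fin nx) (Fin r) ℝ) (sv : Fin r → ℝ),
      Pᵀ * P = 1 ∧ Qᵀ * Q = 1 ∧ (∀ j, 0 < sv j) ∧
      euclToMatrix (Ul n t i ω) = P * Matrix.diagonal sv * Qᵀ ∧
      euclToMatrix (Xl n t (i + 1) ω) = euclToMatrix (Xl n t i ω) - etax • (P * Qᵀ))
    (hYlS : ∀ n t i, i < p → ∀ ω, ∃ (r : ℕ) (R : Matrix (Fin my) (Fin r) ℝ)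
      (S : Matrix (Fin ny) (Fin r) ℝ) (sv : Fin r → ℝ),
      Rᵀ * R = 1 ∧ Sᵀ * S = 1 ∧ (∀ j, 0 < sv j) ∧
      euclToMatrix (Vl n t i ω) = R * Matrix.diagonal sv * Sᵀ ∧
      euclToMatrix (Yl n t (i + 1) ω) = euclToMatrix (Yl n t i ω) + etay • (R * Sᵀ))
    -- local momenta with control variates (round 0 uses the initial values)
    (hUl0 : ∀ n i, Ul n 0 i =
      fun ω => betax • (Dx n 0 i ω + gXinit ω - gXlinit n ω) + (1 - betax) • Uinit ω)
    (hUlS : ∀ n t i, Ul n (t + 1) i =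
      fun ω => betax • (Dx n (t + 1) i ω + gXg t ω - gXl n t ω) + (1 - betax) • Ug t ω)
    (hVl0 : ∀ n i, Vl n 0 i =
      fun ω => betay • (Dy n 0 i ω + gYinit ω - gYlinit n ω) + (1 - betay) • Vinit ω)
    (hVlS : ∀ n t i, Vl n (t + 1) i =
      fun ω => betay • (Dy n (t + 1) i ω + gYg t ω - gYl n t ω) + (1 - betay) • Vg t ω)
    -- control variates
    (hgXl : ∀ n t, gXl n t = fun ω => (p : ℝ)⁻¹ • ∑ i ∈ Finset.range p, Dx n t i ω)
    (hgYl : ∀ n t, gYl n t = fun ω => (p : ℝ)⁻¹ • ∑ i ∈ Finset.range p, Dy n t i ω)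
    (hgXg : ∀ t, gXg t = fun ω => (N : ℝ)⁻¹ • ∑ n, gXl n t ω)
    (hgYg : ∀ t, gYg t = fun ω => (N : ℝ)⁻¹ • ∑ n, gYl n t ω)
    -- global updates and global momenta
    (hXgS : ∀ t, Xg (t + 1) =
      fun ω => Xg t ω + (gammax / (etax * N * p)) • ∑ n, (Xl n t p ω - Xg t ω))
    (hYgS : ∀ t, Yg (t + 1) =
      fun ω => Yg t ω + (gammay / (etay * N * p)) • ∑ n, (Yl n t p ω - Yg t ω))
    (hUg0 : Ug 0 = fun ω => betax • gXg 0 ω + (1 - betax) • Uinit ω)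
    (hUgS : ∀ t, Ug (t + 1) = fun ω => betax • gXg (t + 1) ω + (1 - betax) • Ug t ω)
    (hVg0 : Vg 0 = fun ω => betay • gYg 0 ω + (1 - betay) • Vinit ω)
    (hVgS : ∀ t, Vg (t + 1) = fun ω => betay • gYg (t + 1) ω + (1 - betay) • Vg t ω)
    -- Assumption 3 (heavy-tailed noise): the stochastic gradients are integrable,
    -- adapted to the filtration indexed lexicographically by (round, local step,
    -- client), conditionally unbiased, and have bounded s-th noise moment
    (hDxint : ∀ n t i, Integrable (Dx n t i) μ)
    (hDyint : ∀ n t i, Integrable (Dy n t i) μ)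
    (hDxadapt : ∀ (n : Fin N) (t i : ℕ),
      StronglyMeasurable[F ((t * p + i) * N + (n : ℕ) + 1)] (Dx n t i))
    (hDyadapt : ∀ (n : Fin N) (t i : ℕ),
      StronglyMeasurable[F ((t * p + i) * N + (n : ℕ) + 1)] (Dy n t i))
    (hiteradapt : ∀ (n : Fin N) (t i : ℕ),
      StronglyMeasurable[F ((t * p + i) * N)] (Xl n t i) ∧
      StronglyMeasurable[F ((t * p + i) * N)] (Yl n t i))
    (hunbx : ∀ (n : Fin N) (t i : ℕ),
      μ[fun ω => Dx n t i ω - Gx n (Xl n t i ω) (Yl n t i ω)|F ((t * p + i) * N + (n : ℕ))]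
        =ᵐ[μ] 0)
    (hunby : ∀ (n : Fin N) (t i : ℕ),
      μ[fun ω => Dy n t i ω - Gy n (Xl n t i ω) (Yl n t i ω)|F ((t * p + i) * N + (n : ℕ))]
        =ᵐ[μ] 0)
    (hmomx : ∀ (n : Fin N) (t i : ℕ),
      ∫ ω, ‖Dx n t i ω - Gx n (Xl n t i ω) (Yl n t i ω)‖ ^ s ∂μ ≤ sigma ^ s)
    (hmomy : ∀ (n : Fin N) (t i : ℕ),
      ∫ ω, ‖Dy n t i ω - Gy n (Xl n t i ω) (Yl n t i ω)‖ ^ s ∂μ ≤ sigma ^ s) :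
    ∀ t : ℕ,
      (∫ ω, fbar (Xg t ω) (Yg t ω) ∂μ) -
          ∫ ω, fbar (Xg (t + 1) ω) (Yg (t + 1) ω) ∂μ ≤
        gammax * Real.sqrt nx * ∫ ω, ‖GPhi (Xg t ω)‖ ∂μ
        + (gammax * Real.sqrt nx * (Lf / mupl) - gammay) *
            ∫ ω, ‖Gybar (Xg t ω) (Yg t ω)‖ ∂μ
        + 2 * gammax * Real.sqrt nx * ∫ ω, ‖Gxbar (Xg t ω) (Yg t ω) - Ug t ω‖ ∂μ
        + 2 * gammay * Real.sqrt ny * ∫ ω, ‖Gybar (Xg t ω) (Yg t ω) - Vg t ω‖ ∂μ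
        + 2 * gammay * Real.sqrt ny * (((1 : ℝ) / (N * p)) *
            ∑ n : Fin N, ∑ i ∈ Finset.range p, ∫ ω, ‖Vg t ω - Vl n t i ω‖ ∂μ)
        + 2 * gammax * Real.sqrt nx * (((1 : ℝ) / (N * p)) *
            ∑ n : Fin N, ∑ i ∈ Finset.range p, ∫ ω, ‖Ug t ω - Ul n t i ω‖ ∂μ)
        + (Lf / 2) * (gammax ^ 2 * nx + gammay ^ 2 * ny + 2 * nx * gammax * gammay) := by
  intro t
  have hN' : (0 : ℝ) < N := by exact_mod_cast hN
  have hNinv : (N : ℝ)⁻¹ * N = 1 := by field_simp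
  -- regularity of the local and global objectives
  have hLipx : ∀ n X Y X' Y',
      ‖Gx n X Y - Gx n X' Y'‖ ≤ Lf * √(‖X - X'‖ ^ 2 + ‖Y - Y'‖ ^ 2) := fun n X Y X' Y' =>
    (Real.le_sqrt_of_sq_le (le_add_of_nonneg_right (sq_nonneg _))).trans (hLip n X Y X' Y')
  have hLipy : ∀ n X Y X' Y',
      ‖Gy n X Y - Gy n X' Y'‖ ≤ Lf * √(‖X - X'‖ ^ 2 + ‖Y - Y'‖ ^ 2) := fun n X Y X' Y' =>
    (Real.le_sqrt_of_sq_le (le_add_of_nonneg_left (sq_nonneg _))).trans (hLip n X Y X' Y')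
  have hcx := fun n => continuous_of_norm_sub_le_sqrt (hLipx n)
  have hcy := fun n => continuous_of_norm_sub_le_sqrt (hLipy n)
  have hcf : ∀ n, Continuous fun z : EuclideanSpace ℝ (Fin mx × Fin nx) ×
      EuclideanSpace ℝ (Fin my × Fin ny) => f n z.1 z.2 := fun n =>
    continuous_iff_continuousAt.2 fun u => (hasFDerivAt_uncurry_of_hasGradientAt
      (hGx n) (hGy n) (hcx n) (hcy n) u).continuousAt
  have hcfbar : Continuous fun z : EuclideanSpace ℝ (Fin mx × Fin nx) ×
      EuclideanSpace ℝ (Fin my × Fin ny) => fbar z.1 z.2 := by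
    simp_rw [hfbar]; fun_prop
  have hcxbar : Continuous fun z : EuclideanSpace ℝ (Fin mx × Fin nx) ×
      EuclideanSpace ℝ (Fin my × Fin ny) => Gxbar z.1 z.2 := by
    simp_rw [hGxbar]; fun_prop
  have hcybar : Continuous fun z : EuclideanSpace ℝ (Fin mx × Fin nx) ×
      EuclideanSpace ℝ (Fin my × Fin ny) => Gybar z.1 z.2 := by
    simp_rw [hGybar]; fun_prop
  have hgxbar : ∀ X Y, HasGradientAt (fun X' => fbar X' Y) (Gxbar X Y) X := by
    intro X Y
    simp_rw [hfbar, hGxbar, hasGradientAt_iff_hasFDerivAt, map_smul, map_sum]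
    exact (HasFDerivAt.fun_sum fun n _ => (hGx n X Y).hasFDerivAt).const_mul _
  have hgybar : ∀ X Y, HasGradientAt (fun Y' => fbar X Y') (Gybar X Y) Y := by
    intro X Y
    simp_rw [hfbar, hGybar, hasGradientAt_iff_hasFDerivAt, map_smul, map_sum]
    exact (HasFDerivAt.fun_sum fun n _ => (hGy n X Y).hasFDerivAt).const_mul _
  have hLipbar : ∀ X Y Y', ‖Gxbar X Y - Gxbar X Y'‖ ≤ Lf * ‖Y - Y'‖ := by
    intro X Y Y'
    rw [hGxbar, hGxbar, ← smul_sub, ← Finset.sum_sub_distrib, norm_smul,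
      Real.norm_of_nonneg (inv_nonneg.2 hN'.le)]
    calc (N : ℝ)⁻¹ * ‖∑ n, (Gx n X Y - Gx n X Y')‖
        ≤ (N : ℝ)⁻¹ * ∑ _n : Fin N, Lf * ‖Y - Y'‖ := by
          gcongr
          refine (norm_sum_le _ _).trans (Finset.sum_le_sum fun n _ => ?_)
          simpa using hLipx n X Y X Y'
      _ = Lf * ‖Y - Y'‖ := by
          simp only [Finset.sum_const, Finset.card_univ, Fintype.card_fin, nsmul_eq_mul]
          linear_combination (Lf * ‖Y - Y'‖) * hNinv
  have hdescent : ∀ X a Y b, fbar X Y - fbar (X + a) (Y + b) ≤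
      -inner ℝ (Gxbar X Y) a - inner ℝ (Gybar X Y) b + Lf / 2 * (‖a‖ ^ 2 + ‖b‖ ^ 2) := by
    intro X a Y b
    have h : ∑ n, (f n X Y - f n (X + a) (Y + b)) ≤ ∑ n, (-inner ℝ (Gx n X Y) a -
        inner ℝ (Gy n X Y) b + Lf / 2 * (‖a‖ ^ 2 + ‖b‖ ^ 2)) :=
      Finset.sum_le_sum fun n _ => sub_le_of_lipschitz_partial_gradients (hGx n) (hGy n) (hLip n)
        (hcx n) (hcy n) X a Y b
    have h' := mul_le_mul_of_nonneg_left h (inv_nonneg.2 hN'.le)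
    simp only [Finset.sum_add_distrib, Finset.sum_sub_distrib, Finset.sum_neg_distrib,
      Finset.sum_const, Finset.card_univ, Fintype.card_fin, nsmul_eq_mul] at h'
    rw [hfbar, hfbar, hGxbar, hGybar, real_inner_smul_left, real_inner_smul_left, sum_inner,
      sum_inner]
    linear_combination h' + (Lf / 2 * (‖a‖ ^ 2 + ‖b‖ ^ 2)) * hNinv
  have hgap : ∀ X Y, ‖Gxbar X Y‖ ≤ ‖GPhi X‖ + Lf / mupl * ‖Gybar X Y‖ ∧
      ‖GPhi X‖ ≤ ‖Gxbar X Y‖ + Lf / mupl * ‖Gybar X Y‖ := by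
    intro X Y
    have h := norm_partial_gradient_sub_le_of_pl (f := fbar) (Gx := Gxbar) (Gy := Gybar)
      hLf.le hmupl (hgxbar X) (hgybar X) (hGPhi X)
      (fun X Y => by rw [hPhi]; exact hYstar X Y) (fun Y => by rw [hPhi]; exact hPL X Y)
      (hLipbar X) Y
    have h1 := norm_sub_norm_le (Gxbar X Y) (GPhi X)
    have h2 := norm_sub_norm_le (GPhi X) (Gxbar X Y)
    rw [norm_sub_rev] at h2
    constructor <;> linarith
  -- the global steps
  have hstepX : ∀ t ω, ∃ W : EuclideanSpace ℝ (Fin mx × Fin nx),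
      Xg (t + 1) ω = Xg t ω + (-gammax) • W ∧ ‖W‖ ≤ √nx := by
    intro t ω
    obtain ⟨W, h1, h2, -⟩ := exists_average_orthonormalized_step hN hp (neg_ne_zero.2 hetax.ne')
      (-gammax) (Z := Xg t ω) (Zl := fun n i => Xl n t i ω) (M := fun n i => Ul n t i ω)
      (fun n => by rw [hXl0]) (fun n i hi => by
        simpa only [neg_smul, ← sub_eq_add_neg] using hXlS n t i hi ω)
    refine ⟨W, ?_, h2⟩
    rw [hXgS, ← h1, neg_mul, neg_mul, neg_div_neg_eq]
  have hstepY : ∀ t ω, ∃ W : EuclideanSpace ℝ (Fin my × Fin ny),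
      Yg (t + 1) ω = Yg t ω + gammay • W ∧ ‖W‖ ≤ √ny ∧
      ∀ G V, ‖G‖ - 2 * √ny * (‖G - V‖ + (1 : ℝ) / (N * p) *
        ∑ n : Fin N, ∑ i ∈ Finset.range p, ‖V - Vl n t i ω‖) ≤ inner ℝ G W := by
    intro t ω
    obtain ⟨W, h1, h2⟩ := exists_average_orthonormalized_step hN hp hetay.ne'
      gammay (Z := Yg t ω) (Zl := fun n i => Yl n t i ω) (M := fun n i => Vl n t i ω)
      (fun n => by rw [hYl0]) (fun n i hi => hYlS n t i hi ω)
    refine ⟨W, ?_, h2⟩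
    rw [hYgS, ← h1]
  have hpoint : ∀ ω, fbar (Xg t ω) (Yg t ω) - fbar (Xg (t + 1) ω) (Yg (t + 1) ω) ≤
      gammax * √nx * ‖GPhi (Xg t ω)‖
      + (gammax * √nx * (Lf / mupl) - gammay) * ‖Gybar (Xg t ω) (Yg t ω)‖
      + 2 * gammay * √ny * ‖Gybar (Xg t ω) (Yg t ω) - Vg t ω‖
      + 2 * gammay * √ny * (((1 : ℝ) / (N * p)) *
          ∑ n : Fin N, ∑ i ∈ Finset.range p, ‖Vg t ω - Vl n t i ω‖)
      + (Lf / 2) * (gammax ^ 2 * nx + gammay ^ 2 * ny + 2 * nx * gammax * gammay) := by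
    intro ω
    obtain ⟨W, hW, hWn⟩ := hstepX t ω
    obtain ⟨R, hR, hRn, hRi⟩ := hstepY t ω
    have h1 := hdescent (Xg t ω) ((-gammax) • W) (Yg t ω) (gammay • R)
    rw [← hW, ← hR, real_inner_smul_right, real_inner_smul_right, norm_smul, norm_smul, norm_neg,
      Real.norm_of_nonneg hgammax.le, Real.norm_of_nonneg hgammay.le] at h1
    have h2 := mul_le_mul_of_nonneg_left (hRi (Gybar (Xg t ω) (Yg t ω)) (Vg t ω)) hgammay.le
    have h3 : inner ℝ (Gxbar (Xg t ω) (Yg t ω)) W ≤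
        √nx * (‖GPhi (Xg t ω)‖ + Lf / mupl * ‖Gybar (Xg t ω) (Yg t ω)‖) :=
      calc inner ℝ (Gxbar (Xg t ω) (Yg t ω)) W ≤ ‖Gxbar (Xg t ω) (Yg t ω)‖ * ‖W‖ :=
            real_inner_le_norm _ _
        _ ≤ ‖Gxbar (Xg t ω) (Yg t ω)‖ * √nx := by gcongr
        _ = √nx * ‖Gxbar (Xg t ω) (Yg t ω)‖ := mul_comm _ _
        _ ≤ _ := by gcongr; exact (hgap _ _).1
    have h4 := mul_le_mul_of_nonneg_left h3 hgammax.le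
    have h5 : (gammax * ‖W‖) ^ 2 ≤ gammax ^ 2 * nx := by
      rw [mul_pow]
      gcongr
      simpa using pow_le_pow_left₀ (norm_nonneg _) hWn 2
    have h6 : (gammay * ‖R‖) ^ 2 ≤ gammay ^ 2 * ny := by
      rw [mul_pow]
      gcongr
      simpa using pow_le_pow_left₀ (norm_nonneg _) hRn 2
    have h7 : 0 ≤ 2 * (nx : ℝ) * gammax * gammay := by positivity
    have h8 : Lf / 2 * ((gammax * ‖W‖) ^ 2 + (gammay * ‖R‖) ^ 2) ≤
        (Lf / 2) * (gammax ^ 2 * nx + gammay ^ 2 * ny + 2 * nx * gammax * gammay) := by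
      refine mul_le_mul_of_nonneg_left ?_ (by positivity)
      linarith
    linear_combination h1 + h2 + h4 + h8
  -- integrability of every term
  have hmX : ∀ t, StronglyMeasurable (Xg t) := fun t => by
    rw [← hXl0 ⟨0, hN⟩ t]; exact (hiteradapt ⟨0, hN⟩ t 0).1.mono (F.le _)
  have hmY : ∀ t, StronglyMeasurable (Yg t) := fun t => by
    rw [← hYl0 ⟨0, hN⟩ t]; exact (hiteradapt ⟨0, hN⟩ t 0).2.mono (F.le _)
  have hbX : ∀ t, ∃ c, ∀ ω, ‖Xg t ω‖ ≤ c := by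
    intro t
    induction t with
    | zero => exact ⟨‖X0‖, fun ω => by rw [hX0]⟩
    | succ t ih =>
      obtain ⟨c, hc⟩ := ih
      refine ⟨c + gammax * √nx, fun ω => ?_⟩
      obtain ⟨W, hW, hWn⟩ := hstepX t ω
      rw [hW]
      refine (norm_add_le _ _).trans (add_le_add (hc ω) ?_)
      rw [norm_smul, norm_neg, Real.norm_of_nonneg hgammax.le]
      gcongr
  have hbY : ∀ t, ∃ c, ∀ ω, ‖Yg t ω‖ ≤ c := by
    intro t
    induction t with
    | zero => exact ⟨‖Y0‖, fun ω => by rw [hY0]⟩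
    | succ t ih =>
      obtain ⟨c, hc⟩ := ih
      refine ⟨c + gammay * √ny, fun ω => ?_⟩
      obtain ⟨W, hW, hWn, -⟩ := hstepY t ω
      rw [hW]
      refine (norm_add_le _ _).trans (add_le_add (hc ω) ?_)
      rw [norm_smul, Real.norm_of_nonneg hgammay.le]
      gcongr
  have hif : ∀ t, Integrable (fun ω => fbar (Xg t ω) (Yg t ω)) μ := fun t =>
    integrable_of_continuous_of_bounded hcfbar (hmX t) (hmY t) (hbX t) (hbY t)
  have hiGx : Integrable (fun ω => Gxbar (Xg t ω) (Yg t ω)) μ :=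
    integrable_of_continuous_of_bounded hcxbar (hmX t) (hmY t) (hbX t) (hbY t)
  have hiGy : Integrable (fun ω => Gybar (Xg t ω) (Yg t ω)) μ :=
    integrable_of_continuous_of_bounded hcybar (hmX t) (hmY t) (hbX t) (hbY t)
  have hiPhi : Integrable (fun ω => GPhi (Xg t ω)) μ := by
    refine (hiGx.norm.add (hiGy.norm.const_mul (Lf / mupl))).mono'
      ((measurable_of_hasGradientAt hGPhi).comp (hmX t).measurable).aestronglyMeasurable
      (.of_forall fun ω => (hgap _ _).2)
  have higYl : ∀ n t, Integrable (gYl n t) μ := fun n t => by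
    rw [hgYl]; exact (integrable_finsetSum (Finset.range p) fun i _ => hDyint n t i).fun_smul _
  have higYg : ∀ t, Integrable (gYg t) μ := fun t => by
    rw [hgYg]; exact (integrable_finsetSum Finset.univ fun n _ => higYl n t).fun_smul _
  have hiVg : ∀ t, Integrable (Vg t) μ := by
    intro t
    induction t with
    | zero => rw [hVg0]; exact ((higYg 0).fun_smul _).fun_add (hinitint.2.1.fun_smul _)
    | succ t ih => rw [hVgS]; exact ((higYg (t + 1)).fun_smul _).fun_add (ih.fun_smul _)
  have hiVl : ∀ n i, Integrable (Vl n t i) μ := by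
    intro n i
    cases t with
    | zero =>
      rw [hVl0]
      exact ((((hDyint n 0 i).fun_add hinitint.2.2.2.1).sub' (hinitint.2.2.2.2.2 n)).fun_smul _).add
        (hinitint.2.1.fun_smul _)
    | succ t =>
      rw [hVlS]
      exact ((((hDyint n (t + 1) i).fun_add (higYg t)).sub' (higYl n t)).fun_smul _).fun_add ((hiVg t).fun_smul _)
  have hi1 := hiPhi.norm.const_mul (gammax * √nx)
  have hi2 := hiGy.norm.const_mul (gammax * √nx * (Lf / mupl) - gammay)
  have hi3 := (hiGy.sub' (hiVg t)).norm.const_mul (2 * gammay * √ny)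
  have hi4 : Integrable (fun ω => ∑ n : Fin N, ∑ i ∈ Finset.range p, ‖Vg t ω - Vl n t i ω‖) μ :=
    integrable_finsetSum _ fun n _ => integrable_finsetSum _ fun i _ =>
      ((hiVg t).sub' (hiVl n i)).norm
  have hi5 := (hi4.const_mul ((1 : ℝ) / (N * p))).const_mul (2 * gammay * √ny)
  have hsum : ∫ ω, ∑ n : Fin N, ∑ i ∈ Finset.range p, ‖Vg t ω - Vl n t i ω‖ ∂μ =
      ∑ n : Fin N, ∑ i ∈ Finset.range p, ∫ ω, ‖Vg t ω - Vl n t i ω‖ ∂μ := by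
    rw [integral_finsetSum _ fun n _ => integrable_finsetSum _ fun i _ =>
      ((hiVg t).sub' (hiVl n i)).norm]
    exact Finset.sum_congr rfl fun n _ =>
      integral_finsetSum _ fun i _ => ((hiVg t).sub' (hiVl n i)).norm
  have hi12 := hi1.fun_add hi2
  have hi123 := hi12.fun_add hi3
  have hi1235 := hi123.fun_add hi5
  have hint := integral_mono ((hif t).sub' (hif (t + 1)))
    (hi1235.fun_add (integrable_const _)) hpoint
  rw [integral_sub (hif t) (hif (t + 1)), integral_add hi1235 (integrable_const _),
    integral_add hi123 hi5, integral_add hi12 hi3, integral_add hi1 hi2, integral_const,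
    integral_const_mul, integral_const_mul, integral_const_mul, integral_const_mul,
    integral_const_mul, hsum, probReal_univ, one_smul] at hint
  have hU : 0 ≤ 2 * gammax * √nx * ∫ ω, ‖Gxbar (Xg t ω) (Yg t ω) - Ug t ω‖ ∂μ :=
    mul_nonneg (by positivity) (integral_nonneg fun ω => norm_nonneg _)
  have hUl : 0 ≤ 2 * gammax * √nx * (((1 : ℝ) / (N * p)) *
      ∑ n : Fin N, ∑ i ∈ Finset.range p, ∫ ω, ‖Ug t ω - Ul n t i ω‖ ∂μ) :=
    mul_nonneg (by positivity) (mul_nonneg (by positivity) (Finset.sum_nonneg fun n _ =>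
      Finset.sum_nonneg fun i _ => integral_nonneg fun ω => norm_nonneg _))
  linarith
end

section
/- Let u_1, …, u_m be nonzero vectors in ℝ^d and let u = (1/m) Σ_{j=1}^{m} u_j be their average, assumed nonzero. Then ‖u‖ · ‖ (1/m) Σ_{j=1}^{m} u_j/‖u_j‖ − u/‖u‖ ‖ ≤ (1/m) Σ_{j=1}^{m} | ‖u‖ − ‖u_j‖ | ≤ (1/m) Σ_{j=1}^{m} ‖u − u_j‖. -/
/-- normalization discrepancy bound: for nonzero vectors
`u 1, …, u m` in `ℝ^d` with nonzero average `ubar = (1/m) ∑ u j`,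
`‖ubar‖ · ‖(1/m) ∑ u j/‖u j‖ − ubar/‖ubar‖‖ ≤ (1/m) ∑ |‖ubar‖ − ‖u j‖|
≤ (1/m) ∑ ‖ubar − u j‖`. -/
theorem normalized_average_discrepancy
    {d : ℕ} (m : ℕ) (hm : 0 < m)
    (u : Fin m → EuclideanSpace ℝ (Fin d)) (hu : ∀ j, u j ≠ 0)
    (ubar : EuclideanSpace ℝ (Fin d))
    (hubar : ubar = (m : ℝ)⁻¹ • ∑ j, u j) (hne : ubar ≠ 0) :
    ‖ubar‖ * ‖(m : ℝ)⁻¹ • (∑ j, ‖u j‖⁻¹ • u j) - ‖ubar‖⁻¹ • ubar‖ ≤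
        (m : ℝ)⁻¹ * ∑ j, |‖ubar‖ - ‖u j‖| ∧
    (m : ℝ)⁻¹ * ∑ j, |‖ubar‖ - ‖u j‖| ≤ (m : ℝ)⁻¹ * ∑ j, ‖ubar - u j‖ := by
  refine ⟨?_, by gcongr; exact abs_norm_sub_norm_le _ _⟩
  have hterm (j : Fin m) :
      (‖ubar‖ - ‖u j‖) • ‖u j‖⁻¹ • u j = ‖ubar‖ • ‖u j‖⁻¹ • u j - u j := by
    rw [sub_smul, smul_inv_smul₀ (norm_ne_zero_iff.mpr (hu j))]
  have hsum : ‖ubar‖ • ((m : ℝ)⁻¹ • (∑ j, ‖u j‖⁻¹ • u j) - ‖ubar‖⁻¹ • ubar) =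
      (m : ℝ)⁻¹ • ∑ j, (‖ubar‖ - ‖u j‖) • ‖u j‖⁻¹ • u j := by
    simp only [hterm]
    rw [smul_sub, smul_inv_smul₀ (norm_ne_zero_iff.mpr hne), Finset.sum_sub_distrib, smul_sub,
      ← hubar, ← Finset.smul_sum, smul_comm]
  calc
    _ = ‖(m : ℝ)⁻¹ • ∑ j, (‖ubar‖ - ‖u j‖) • ‖u j‖⁻¹ • u j‖ := by
      rw [← hsum, norm_smul, norm_norm]
    _ = (m : ℝ)⁻¹ * ‖∑ j, (‖ubar‖ - ‖u j‖) • ‖u j‖⁻¹ • u j‖ :=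
      norm_smul_of_nonneg (by positivity) _
    _ ≤ (m : ℝ)⁻¹ * ∑ j, |‖ubar‖ - ‖u j‖| := by
      gcongr
      refine norm_sum_le_of_le _ fun j _ => ?_
      rw [norm_smul, norm_smul, norm_inv, norm_norm,
        inv_mul_cancel₀ (norm_ne_zero_iff.mpr (hu j)), mul_one, Real.norm_eq_abs]
end

section
/- Let U ∈ ℝ^{m×n} with m ≥ n and rank(U) = n, and let U = P Σ Qᵀ be its thin singular value decomposition with P ∈ ℝ^{m×n}, Q ∈ ℝ^{n×n} having orthonormal columns and Σ ∈ ℝ^{n×n} diagonal with positive entries. Then O* = P Qᵀ is the minimizer of ‖O − U‖_F over all O ∈ ℝ^{m×n} satisfying OᵀO = I_n; that is, for every semi-orthogonal O ∈ ℝ^{m×n}, ‖PQᵀ − U‖_F ≤ ‖O − U‖_F. -/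
open Matrix

/-- The Frobenius norm of a real matrix. -/
noncomputable def frobeniusNorm {m n : ℕ} (A : Matrix (Fin m) (Fin n) ℝ) : ℝ :=
  Real.sqrt (∑ i, ∑ j, (A i j) ^ 2)

/-- The squared Frobenius norm is the trace of the Gram matrix. -/
theorem sum_sq_eq_trace_transpose_mul {ι κ : Type*} [Fintype ι] [Fintype κ]
    (A : Matrix ι κ ℝ) : ∑ i, ∑ j, (A i j) ^ 2 = (Aᵀ * A).trace := by
  rw [Finset.sum_comm]
  simp [Matrix.trace, Matrix.mul_apply, sq]

/-- The squared Frobenius distance from a matrix with orthonormal columns. -/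
theorem trace_gram_sub_of_gram_eq_one {ι κ : Type*} [Fintype ι] [Fintype κ] [DecidableEq κ]
    {O : Matrix ι κ ℝ} (hO : Oᵀ * O = 1) (U : Matrix ι κ ℝ) :
    ((O - U)ᵀ * (O - U)).trace =
      (1 : Matrix κ κ ℝ).trace - 2 * (Oᵀ * U).trace + (Uᵀ * U).trace := by
  have h : (Uᵀ * O).trace = (Oᵀ * U).trace := by
    rw [← Matrix.trace_transpose, Matrix.transpose_mul, Matrix.transpose_transpose]
  simp only [Matrix.transpose_sub, Matrix.sub_mul, Matrix.mul_sub, Matrix.trace_sub, hO, h]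
  ring

/-- Corresponding columns of two matrices with orthonormal columns have inner product
at most one. -/
theorem transpose_mul_apply_self_le_one {ι κ : Type*} [Fintype ι] [DecidableEq κ]
    {W P : Matrix ι κ ℝ} (hW : Wᵀ * W = 1) (hP : Pᵀ * P = 1) (j : κ) :
    (Wᵀ * P) j j ≤ 1 := by
  have hWj := congrFun (congrFun hW j) j
  have hPj := congrFun (congrFun hP j) j
  simp only [Matrix.mul_apply, Matrix.transpose_apply, Matrix.one_apply_eq] at hWj hPj ⊢
  have h : 0 ≤ ∑ i, (W i j - P i j) ^ 2 := Finset.sum_nonneg fun i _ => sq_nonneg _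
  have hexp : ∑ i, (W i j - P i j) ^ 2 =
      ∑ i, W i j * W i j - 2 * ∑ i, W i j * P i j + ∑ i, P i j * P i j := by
    rw [Finset.mul_sum, ← Finset.sum_sub_distrib, ← Finset.sum_add_distrib]
    exact Finset.sum_congr rfl fun i _ => by ring
  linarith

/-- The pairing of a matrix with a singular value decomposition, expressed through the
singular values. -/
theorem trace_transpose_mul_svd {ι κ : Type*} [Fintype ι] [Fintype κ] [DecidableEq κ]
    (O P : Matrix ι κ ℝ) (Q : Matrix κ κ ℝ) (s : κ → ℝ) :
    (Oᵀ * (P * Matrix.diagonal s * Qᵀ)).trace = ∑ j, ((O * Q)ᵀ * P) j j * s j := by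
  rw [← Matrix.mul_assoc, Matrix.trace_mul_comm, ← Matrix.mul_assoc, ← Matrix.mul_assoc,
    ← Matrix.transpose_mul]
  simp [Matrix.trace, Matrix.mul_diagonal]

/-- orthonormalization step of Muon: if `U ∈ ℝ^{m×n}` with `m ≥ n`
has full column rank `n`, and `U = P Σ Qᵀ` is its thin SVD (with `P ∈ ℝ^{m×n}`,
`Q ∈ ℝ^{n×n}` semi-orthogonal and `Σ` diagonal with positive entries), then `P Qᵀ`
minimizes `‖O − U‖_F` over all semi-orthogonal `O ∈ ℝ^{m×n}` (i.e. `OᵀO = Iₙ`). -/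
theorem muon_orthonormalization_optimal
    (m n : ℕ) (hmn : n ≤ m)
    (U P : Matrix (Fin m) (Fin n) ℝ) (Q : Matrix (Fin n) (Fin n) ℝ)
    (Sig : Fin n → ℝ)
    (hrank : U.rank = n)
    (hP : Pᵀ * P = 1) (hQ : Qᵀ * Q = 1)
    (hSig : ∀ j, 0 < Sig j)
    (hU : U = P * Matrix.diagonal Sig * Qᵀ) :
    ∀ O : Matrix (Fin m) (Fin n) ℝ, Oᵀ * O = 1 →
      frobeniusNorm (P * Qᵀ - U) ≤ frobeniusNorm (O - U) := by
  intro O hO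
  have hQ' : Q * Qᵀ = 1 := mul_eq_one_comm.mp hQ
  have hPQ : (P * Qᵀ)ᵀ * (P * Qᵀ) = 1 := by
    rw [Matrix.transpose_mul, Matrix.transpose_transpose, Matrix.mul_assoc,
      ← Matrix.mul_assoc Pᵀ, hP, Matrix.one_mul, hQ']
  have hOQ : (O * Q)ᵀ * (O * Q) = 1 := by
    rw [Matrix.transpose_mul, Matrix.mul_assoc, ← Matrix.mul_assoc Oᵀ, hO, Matrix.one_mul, hQ]
  have hle : (Oᵀ * U).trace ≤ ((P * Qᵀ)ᵀ * U).trace := by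
    rw [hU, trace_transpose_mul_svd, trace_transpose_mul_svd, Matrix.mul_assoc P, hQ,
      Matrix.mul_one, hP]
    refine Finset.sum_le_sum fun j _ => mul_le_mul_of_nonneg_right ?_ (hSig j).le
    rw [Matrix.one_apply_eq]
    exact transpose_mul_apply_self_le_one hOQ hP j
  unfold frobeniusNorm
  apply Real.sqrt_le_sqrt
  rw [sum_sq_eq_trace_transpose_mul, sum_sq_eq_trace_transpose_mul,
    trace_gram_sub_of_gram_eq_one hPQ, trace_gram_sub_of_gram_eq_one hO]
  linarith
end
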